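/- (Flat-space case of the obstacle-avoidance theorem.) Let E be a finite-dimensional real inner product space, T > 0, σ ≥ 0, let V : E → ℝ be continuously differentiable, m a natural number, and for each a ∈ {1,…,m} let X_a : E → E be a twice continuously differentiable vector field. Let c : ℝ → E be four times continuously differentiable on [0,T] and λ_a : ℝ → ℝ twice continuously differentiable. Define J(c̃, λ̃) = ∫₀ᵀ ( ½( ‖c̃''(t)‖² + σ‖c̃'(t)‖² + V(c̃(t)) ) + Σ_a λ̃_a(t) ⟪X_a(c̃(t)), c̃''(t)⟫ ) dt. Suppose that for every smooth γ : ℝ → E with γ(0) = γ(T) = 0 and γ'(0) = γ'(T) = 0 and every smooth η_a : ℝ → ℝ, the derivative at s = 0 of s ↦ J(c + sγ, λ + sη) is zero. Then for every t ∈ [0,T]: (i) ⟪X_a(c(t)), c''(t)⟫ = 0 for every a, and (ii) for every w ∈ E, ⟪c''''(t) − σ c''(t) + ½ grad V(c(t)), w⟫ + Σ_a [ λ_a''(t) ⟪X_a(c(t)), w⟫ + 2λ_a'(t) ⟪(X_a∘c)'(t), w⟫ + λ_a(t) ⟪(X_a∘c)''(t), w⟫ + λ_a(t) ⟪(fderiv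 X_a (c(t)))(w), c''(t)⟫ ] = 0. -/

import Mathlib

open RealInnerProductSpace intervalIntegral

lemma aux_param (T : ℝ) (F F' : ℝ → ℝ → ℝ)
    (hF : ∀ s, Continuous (F s))
    (hF' : Continuous (Function.uncurry F'))
    (h : ∀ s t, HasDerivAt (fun s => F s t) (F' s t) s) :
    HasDerivAt (fun s => ∫ t in (0:ℝ)..T, F s t) (∫ t in (0:ℝ)..T, F' 0 t) 0 := by
  obtain ⟨C, hC⟩ := ((isCompact_Icc (a := (-1:ℝ)) (b := 1)).prod
    (isCompact_uIcc (a := (0:ℝ)) (b := T))).exists_bound_of_continuousOn hF'.continuousOn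
  have hF0 : Continuous (F' 0) := hF'.comp (Continuous.prodMk_right (0:ℝ))
  refine (intervalIntegral.hasDerivAt_integral_of_dominated_loc_of_deriv_le
    (s := Set.Icc (-1:ℝ) 1) (bound := fun _ => C)
    (Icc_mem_nhds (by norm_num) (by norm_num))
    (Filter.Eventually.of_forall fun s => (hF s).aestronglyMeasurable)
    ((hF 0).intervalIntegrable _ _) hF0.aestronglyMeasurable
    (Filter.Eventually.of_forall fun t ht s hs => ?_)
    (continuous_const.intervalIntegrable _ _)
    (Filter.Eventually.of_forall fun t ht s hs => h s t)).2
  exact hC (s, t) ⟨hs, Set.uIoc_subset_uIcc ht⟩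

lemma aux_var {E : Type*} [NormedAddCommGroup E] [InnerProductSpace ℝ E]
    (T σ : ℝ) (V : E → ℝ) (hV : ContDiff ℝ 1 V)
    (m : ℕ) (X : Fin m → E → E) (hX : ∀ a, ContDiff ℝ 2 (X a))
    (c c1 c2 γ γ1 γ2 : ℝ → E) (lam η : Fin m → ℝ → ℝ)
    (hc : Continuous c) (hc1 : Continuous c1) (hc2 : Continuous c2)
    (hγ : Continuous γ) (hγ1 : Continuous γ1) (hγ2 : Continuous γ2)
    (hlam : ∀ a, Continuous (lam a)) (hη : ∀ a, Continuous (η a)) :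
    HasDerivAt (fun s : ℝ => ∫ t in (0:ℝ)..T,
        (1/2 : ℝ) * (‖c2 t + s • γ2 t‖ ^ 2 + σ * ‖c1 t + s • γ1 t‖ ^ 2
            + V (c t + s • γ t))
          + ∑ a, (lam a t + s * η a t) *
              ⟪X a (c t + s • γ t), c2 t + s • γ2 t⟫)
      (∫ t in (0:ℝ)..T, (⟪c2 t, γ2 t⟫ + σ * ⟪c1 t, γ1 t⟫ + (1/2:ℝ) * fderiv ℝ V (c t) (γ t)
        + ∑ a, (η a t * ⟪X a (c t), c2 t⟫ + lam a t *
          (⟪X a (c t), γ2 t⟫ + ⟪fderiv ℝ (X a) (c t) (γ t), c2 t⟫)))) 0 := by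
  have hXc : ∀ a, Continuous (X a) := fun a => (hX a).continuous
  have hXd : ∀ a, Continuous (fderiv ℝ (X a)) := fun a => (hX a).continuous_fderiv (by norm_num)
  have hVc : Continuous V := hV.continuous
  have hVd : Continuous (fderiv ℝ V) := hV.continuous_fderiv (by norm_num)
  have key := aux_param T (fun s t => (1/2 : ℝ) * (‖c2 t + s • γ2 t‖ ^ 2 + σ * ‖c1 t + s • γ1 t‖ ^ 2
            + V (c t + s • γ t))
          + ∑ a, (lam a t + s * η a t) *
              ⟪X a (c t + s • γ t), c2 t + s • γ2 t⟫)
    (fun s t => (1/2 : ℝ) * (2 * ⟪c2 t + s • γ2 t, γ2 t⟫ + σ * (2 * ⟪c1 t + s • γ1 t, γ1 t⟫)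
            + fderiv ℝ V (c t + s • γ t) (γ t))
          + ∑ a, (η a t * ⟪X a (c t + s • γ t), c2 t + s • γ2 t⟫ + (lam a t + s * η a t) *
              (⟪X a (c t + s • γ t), γ2 t⟫
                + ⟪fderiv ℝ (X a) (c t + s • γ t) (γ t), c2 t + s • γ2 t⟫)))
    (fun s => by fun_prop) ?_ ?_
  · convert key using 3 with t
    simp only [zero_smul, add_zero, zero_mul]
    ring
  · have e1 : Continuous fun p : ℝ × ℝ => fderiv ℝ V (c p.2 + p.1 • γ p.2) (γ p.2) :=
      (hVd.comp (by fun_prop)).clm_apply (by fun_prop)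
    have e2 : ∀ a, Continuous fun p : ℝ × ℝ => fderiv ℝ (X a) (c p.2 + p.1 • γ p.2) (γ p.2) :=
      fun a => ((hXd a).comp (by fun_prop)).clm_apply (by fun_prop)
    simp only [Function.uncurry_def]
    fun_prop
  · intro s t
    have hp : ∀ a b : E, HasDerivAt (fun s : ℝ => a + s • b) b s := fun a b => by
      simpa using ((hasDerivAt_id s).smul_const b).const_add a
    have hq : ∀ a b : ℝ, HasDerivAt (fun s : ℝ => a + s * b) b s := fun a b => by
      simpa using ((hasDerivAt_id s).mul_const b).const_add a
    have hV' : HasDerivAt (fun s : ℝ => V (c t + s • γ t)) (fderiv ℝ V (c t + s • γ t) (γ t)) s :=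
      ((hV.differentiable (by norm_num) (c t + s • γ t)).hasFDerivAt).comp_hasDerivAt s (hp _ _)
    have hX' : ∀ a, HasDerivAt (fun s : ℝ => X a (c t + s • γ t))
        (fderiv ℝ (X a) (c t + s • γ t) (γ t)) s := fun a =>
      (((hX a).differentiable (by norm_num) (c t + s • γ t)).hasFDerivAt).comp_hasDerivAt s (hp _ _)
    exact ((((hp (c2 t) (γ2 t)).norm_sq.add ((hp (c1 t) (γ1 t)).norm_sq.const_mul σ)).add
      hV').const_mul (1/2:ℝ)).add (HasDerivAt.fun_sum fun a _ =>
        (hq (lam a t) (η a t)).mul ((hX' a).inner ℝ (hp (c2 t) (γ2 t))))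

lemma aux_fund (T : ℝ) (hT : 0 < T) (g : ℝ → ℝ) (hg : Continuous g)
    (h : ∀ φ : ℝ → ℝ, ContDiff ℝ (⊤ : ℕ∞) φ → tsupport φ ⊆ Set.Ioo 0 T →
      ∫ t in (0:ℝ)..T, φ t * g t = 0) : ∀ t ∈ Set.Icc 0 T, g t = 0 := by
  have h1 := isOpen_Ioo.ae_eq_zero_of_integral_contDiff_smul_eq_zero (U := Set.Ioo 0 T)
    (μ := MeasureTheory.volume) (hg.locallyIntegrable.locallyIntegrableOn _)
    (fun φ hφ _ hs => by
      rw [← h φ hφ hs, intervalIntegral.integral_eq_integral_of_support_subset]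
      · rfl
      · intro x hx
        refine Set.Ioo_subset_Ioc_self (hs (subset_tsupport _ ?_))
        intro h0
        exact hx (by simp [h0]))
  have h2 : g =ᵐ[MeasureTheory.volume.restrict (Set.Ioo 0 T)] fun _ => 0 :=
    (MeasureTheory.ae_restrict_iff' measurableSet_Ioo).2 h1
  have h3 := MeasureTheory.Measure.eqOn_Ioo_of_ae_eq _ h2 hg.continuousOn continuousOn_const
  have h4 := h3.closure hg continuous_const
  rw [closure_Ioo hT.ne] at h4
  exact h4

lemma aux_parts (T : ℝ) (A A1 A2 B B1 C φ φ1 φ2 : ℝ → ℝ)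
    (hA : ∀ t, HasDerivAt A (A1 t) t) (hA1 : ∀ t, HasDerivAt A1 (A2 t) t)
    (hB : ∀ t, HasDerivAt B (B1 t) t) (hφ : ∀ t, HasDerivAt φ (φ1 t) t)
    (hφ1 : ∀ t, HasDerivAt φ1 (φ2 t) t) (hA2 : Continuous A2) (hB1 : Continuous B1)
    (hC : Continuous C) (hφ2 : Continuous φ2)
    (h0 : φ 0 = 0) (hT0 : φ T = 0) (h10 : φ1 0 = 0) (h1T : φ1 T = 0)
    (h : ∫ t in (0:ℝ)..T, (φ2 t * A t + φ1 t * B t + φ t * C t) = 0) :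
    ∫ t in (0:ℝ)..T, φ t * (A2 t - B1 t + C t) = 0 := by
  have cA : Continuous A := continuous_iff_continuousAt.2 fun t => (hA t).continuousAt
  have cB : Continuous B := continuous_iff_continuousAt.2 fun t => (hB t).continuousAt
  have cφ : Continuous φ := continuous_iff_continuousAt.2 fun t => (hφ t).continuousAt
  have cφ1 : Continuous φ1 := continuous_iff_continuousAt.2 fun t => (hφ1 t).continuousAt
  have e := intervalIntegral.integral_eq_sub_of_hasDerivAt (a := 0) (b := T)
    (f := fun t => φ1 t * A t - φ t * A1 t + φ t * B t)
    (f' := fun t => (φ2 t * A t + φ1 t * A1 t) - (φ1 t * A1 t + φ t * A2 t)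
      + (φ1 t * B t + φ t * B1 t))
    (fun t _ => (((hφ1 t).mul (hA t)).sub ((hφ t).mul (hA1 t))).add ((hφ t).mul (hB t)))
    (by
      have : (fun t => (φ2 t * A t + φ1 t * A1 t) - (φ1 t * A1 t + φ t * A2 t)
        + (φ1 t * B t + φ t * B1 t)) =
        fun t => φ2 t * A t - φ t * A2 t + (φ1 t * B t + φ t * B1 t) := by ext; ring
      rw [this]
      exact Continuous.intervalIntegrable (by fun_prop) _ _)
  simp only [h0, hT0, h10, h1T, zero_mul, sub_zero, add_zero] at e
  have cA1 : Continuous A1 := continuous_iff_continuousAt.2 fun t => (hA1 t).continuousAt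
  have e2 : ∫ t in (0:ℝ)..T, φ t * (A2 t - B1 t + C t) =
      (∫ t in (0:ℝ)..T, (φ2 t * A t + φ1 t * B t + φ t * C t)) -
      ∫ t in (0:ℝ)..T, ((φ2 t * A t + φ1 t * A1 t) - (φ1 t * A1 t + φ t * A2 t)
      + (φ1 t * B t + φ t * B1 t)) := by
    rw [← intervalIntegral.integral_sub (Continuous.intervalIntegrable (by fun_prop) _ _)
      (Continuous.intervalIntegrable (by fun_prop) _ _)]
    congr 1
    ext t
    ring
  rw [e2, h, e, sub_zero]

lemma aux_iter {E : Type*} [NormedAddCommGroup E] [NormedSpace ℝ E] {n : ℕ} {f : ℝ → E}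
    (hf : ContDiff ℝ n f) (k : ℕ) (hk : k < n) (t : ℝ) :
    HasDerivAt (iteratedDeriv k f) (iteratedDeriv (k+1) f t) t := by
  rw [iteratedDeriv_succ]
  exact (hf.differentiable_iteratedDeriv k (by exact_mod_cast hk) t).hasDerivAt

lemma aux_d1 {E : Type*} [NormedAddCommGroup E] [NormedSpace ℝ E] {n : ℕ} {f : ℝ → E}
    (hf : ContDiff ℝ n f) (hk : 0 < n) (t : ℝ) :
    HasDerivAt f (deriv f t) t := by
  simpa using aux_iter hf 0 hk t

lemma aux_d2 {E : Type*} [NormedAddCommGroup E] [NormedSpace ℝ E] {n : ℕ} {f : ℝ → E}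
    (hf : ContDiff ℝ n f) (hk : 1 < n) (t : ℝ) :
    HasDerivAt (deriv f) (iteratedDeriv 2 f t) t := by
  simpa using aux_iter hf 1 hk t

lemma aux_iter2 {E : Type*} [NormedAddCommGroup E] [NormedSpace ℝ E] {f f1 f2 : ℝ → E}
    (h : ∀ t, HasDerivAt f (f1 t) t) (h1 : ∀ t, HasDerivAt f1 (f2 t) t) :
    deriv f = f1 ∧ iteratedDeriv 2 f = f2 := by
  have e : deriv f = f1 := funext fun t => (h t).deriv
  refine ⟨e, ?_⟩
  rw [iteratedDeriv_succ, iteratedDeriv_one, e]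
  exact funext fun t => (h1 t).deriv

/-- Flat-space case of the paper's Theorem 2 (obstacle avoidance): necessary
conditions for normal extremals of the functional
`J(c̃, λ̃) = ∫₀ᵀ ½(‖c̃''‖² + σ‖c̃'‖² + V(c̃)) + Σ_a λ̃_a ⟪X_a(c̃), c̃''⟫ dt`
subject to the linear acceleration constraints. -/
theorem stmt_8 {E : Type*} [NormedAddCommGroup E] [InnerProductSpace ℝ E]
    [FiniteDimensional ℝ E]
    (T σ : ℝ) (hT : 0 < T) (hσ : 0 ≤ σ)
    (V : E → ℝ) (hV : ContDiff ℝ 1 V)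
    (m : ℕ) (X : Fin m → E → E) (hX : ∀ a, ContDiff ℝ 2 (X a))
    (c : ℝ → E) (hc : ContDiff ℝ 4 c)
    (lam : Fin m → ℝ → ℝ) (hlam : ∀ a, ContDiff ℝ 2 (lam a))
    (hcrit : ∀ (γ : ℝ → E) (η : Fin m → ℝ → ℝ),
      ContDiff ℝ (⊤ : ℕ∞) γ → (∀ a, ContDiff ℝ (⊤ : ℕ∞) (η a)) →
      γ 0 = 0 → γ T = 0 → deriv γ 0 = 0 → deriv γ T = 0 →
      deriv (fun s : ℝ => ∫ t in (0:ℝ)..T,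
        (1/2 : ℝ) * (‖iteratedDeriv 2 (fun u => c u + s • γ u) t‖ ^ 2
            + σ * ‖deriv (fun u => c u + s • γ u) t‖ ^ 2
            + V (c t + s • γ t))
          + ∑ a, (lam a t + s * η a t) *
              ⟪X a (c t + s • γ t), iteratedDeriv 2 (fun u => c u + s • γ u) t⟫) 0 = 0) :
    ∀ t ∈ Set.Icc (0:ℝ) T,
      (∀ a, ⟪X a (c t), iteratedDeriv 2 c t⟫ = 0) ∧
      (∀ w : E,
        ⟪iteratedDeriv 4 c t - σ • iteratedDeriv 2 c t
            + (1/2 : ℝ) • gradient V (c t), w⟫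
          + ∑ a, (iteratedDeriv 2 (lam a) t * ⟪X a (c t), w⟫
              + 2 * deriv (lam a) t * ⟪deriv (fun u => X a (c u)) t, w⟫
              + lam a t * ⟪iteratedDeriv 2 (fun u => X a (c u)) t, w⟫
              + lam a t * ⟪fderiv ℝ (X a) (c t) w, iteratedDeriv 2 c t⟫) = 0) := by
  have hc2' : ContDiff ℝ (4:ℕ) c := by exact_mod_cast hc
  have hl' : ∀ a, ContDiff ℝ (2:ℕ) (lam a) := fun a => by exact_mod_cast hlam a
  have hY : ∀ a, ContDiff ℝ (2:ℕ) (fun u => X a (c u)) := fun a =>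
    ((by exact_mod_cast hX a : ContDiff ℝ (2:ℕ) (X a))).comp
      (hc2'.of_le (by norm_num))
  have dc1 := aux_d1 hc2' (by norm_num)
  have dc2 := aux_d2 hc2' (by norm_num)
  have dc3 := aux_iter hc2' 2 (by norm_num)
  have dc4 := aux_iter hc2' 3 (by norm_num)
  have cc : Continuous c := hc.continuous
  have cc1 : Continuous (deriv c) := continuous_iff_continuousAt.2 fun t => (dc2 t).continuousAt
  have cc2 : Continuous (iteratedDeriv 2 c) :=
    continuous_iff_continuousAt.2 fun t => (dc3 t).continuousAt
  have cc4 : Continuous (iteratedDeriv 4 c) := hc2'.continuous_iteratedDeriv 4 le_rfl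
  have dl1 := fun a => aux_d1 (hl' a) (by norm_num)
  have dl2 := fun a => aux_d2 (hl' a) (by norm_num)
  have cl : ∀ a, Continuous (lam a) := fun a => (hl' a).continuous
  have cl1 : ∀ a, Continuous (deriv (lam a)) := fun a =>
    continuous_iff_continuousAt.2 fun t => (dl2 a t).continuousAt
  have cl2 : ∀ a, Continuous (iteratedDeriv 2 (lam a)) := fun a =>
    (hl' a).continuous_iteratedDeriv 2 le_rfl
  have dY1 := fun a => aux_d1 (hY a) (by norm_num)
  have dY2 := fun a => aux_d2 (hY a) (by norm_num)
  have cY : ∀ a, Continuous (fun u => X a (c u)) := fun a => (hY a).continuous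
  have cY1 : ∀ a, Continuous (deriv (fun u => X a (c u))) := fun a =>
    continuous_iff_continuousAt.2 fun t => (dY2 a t).continuousAt
  have cY2 : ∀ a, Continuous (iteratedDeriv 2 (fun u => X a (c u))) := fun a =>
    (hY a).continuous_iteratedDeriv 2 le_rfl
  have cVd : Continuous (fderiv ℝ V) := hV.continuous_fderiv (by norm_num)
  have cXd : ∀ a, Continuous (fderiv ℝ (X a)) := fun a => (hX a).continuous_fderiv (by norm_num)
  -- the first variation vanishes
  have key : ∀ (γ γ1 γ2 : ℝ → E) (η : Fin m → ℝ → ℝ),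
      ContDiff ℝ (⊤ : ℕ∞) γ → (∀ a, ContDiff ℝ (⊤ : ℕ∞) (η a)) →
      (∀ t, HasDerivAt γ (γ1 t) t) → (∀ t, HasDerivAt γ1 (γ2 t) t) → Continuous γ2 →
      γ 0 = 0 → γ T = 0 → γ1 0 = 0 → γ1 T = 0 →
      (∫ t in (0:ℝ)..T, (⟪iteratedDeriv 2 c t, γ2 t⟫ + σ * ⟪deriv c t, γ1 t⟫
        + (1/2:ℝ) * fderiv ℝ V (c t) (γ t)
        + ∑ a, (η a t * ⟪X a (c t), iteratedDeriv 2 c t⟫ + lam a t *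
          (⟪X a (c t), γ2 t⟫ + ⟪fderiv ℝ (X a) (c t) (γ t), iteratedDeriv 2 c t⟫)))) = 0 := by
    intro γ γ1 γ2 η hγ hη h1 h2 h2c g0 gT g10 g1T
    have d1 : deriv γ = γ1 := funext fun t => (h1 t).deriv
    have h := hcrit γ η hγ hη g0 gT (by rw [d1, g10]) (by rw [d1, g1T])
    have hs : ∀ s : ℝ, deriv (fun u => c u + s • γ u) = (fun u => deriv c u + s • γ1 u) ∧
        iteratedDeriv 2 (fun u => c u + s • γ u) = (fun u => iteratedDeriv 2 c u + s • γ2 u) :=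
      fun s => aux_iter2 (fun t => (dc1 t).add ((h1 t).const_smul s))
        (fun t => (dc2 t).add ((h2 t).const_smul s))
    simp only [fun s => (hs s).1, fun s => (hs s).2] at h
    refine Eq.trans (HasDerivAt.deriv ?_).symm h
    exact aux_var T σ V hV m X hX c (deriv c) (iteratedDeriv 2 c) γ γ1 γ2 lam η cc cc1 cc2
      hγ.continuous (continuous_iff_continuousAt.2 fun t => (h2 t).continuousAt) h2c cl
      (fun a => (hη a).continuous)
  have part1 : ∀ a, ∀ t ∈ Set.Icc (0:ℝ) T, ⟪X a (c t), iteratedDeriv 2 c t⟫ = 0 := by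
    intro a
    refine aux_fund T hT _ ((cY a).inner cc2) fun φ hφ hs => ?_
    have := key (fun _ => 0) (fun _ => 0) (fun _ => 0) (fun b => if b = a then φ else fun _ => 0)
      contDiff_const (fun b => by
        by_cases hb : b = a
        · simpa [hb] using hφ
        · simpa [hb] using contDiff_const) (fun t => hasDerivAt_const _ _)
        (fun t => hasDerivAt_const _ _) continuous_const rfl rfl rfl rfl
    refine Eq.trans ?_ this
    congr 1
    ext t
    simp only [inner_zero_right, mul_zero, map_zero, inner_zero_left, add_zero, zero_add]
    rw [Finset.sum_eq_single a]
    · simp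
    · intro b _ hb
      simp [hb]
    · simp
  intro t ht
  refine ⟨fun a => part1 a t ht, fun w => ?_⟩
  let A : ℝ → ℝ := fun t => ⟪iteratedDeriv 2 c t, w⟫ + ∑ a, lam a t * ⟪X a (c t), w⟫
  let A1 : ℝ → ℝ := fun t => ⟪iteratedDeriv 3 c t, w⟫ + ∑ a, (deriv (lam a) t * ⟪X a (c t), w⟫
    + lam a t * ⟪deriv (fun u => X a (c u)) t, w⟫)
  let A2 : ℝ → ℝ := fun t => ⟪iteratedDeriv 4 c t, w⟫ + ∑ a,
    ((iteratedDeriv 2 (lam a) t * ⟪X a (c t), w⟫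
      + deriv (lam a) t * ⟪deriv (fun u => X a (c u)) t, w⟫)
    + (deriv (lam a) t * ⟪deriv (fun u => X a (c u)) t, w⟫
      + lam a t * ⟪iteratedDeriv 2 (fun u => X a (c u)) t, w⟫))
  let B : ℝ → ℝ := fun t => σ * ⟪deriv c t, w⟫
  let B1 : ℝ → ℝ := fun t => σ * ⟪iteratedDeriv 2 c t, w⟫
  let C : ℝ → ℝ := fun t => (1/2:ℝ) * fderiv ℝ V (c t) w
    + ∑ a, lam a t * ⟪fderiv ℝ (X a) (c t) w, iteratedDeriv 2 c t⟫
  have di : ∀ (f : ℝ → E) (f' : E) (t : ℝ), HasDerivAt f f' t →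
      HasDerivAt (fun t => ⟪f t, w⟫) ⟪f', w⟫ t := fun f f' t h => by
    simpa using h.inner ℝ (hasDerivAt_const t w)
  have hA : ∀ t, HasDerivAt A (A1 t) t := fun t =>
    (di _ _ t (dc3 t)).add (HasDerivAt.fun_sum fun a _ => (dl1 a t).mul (di _ _ t (dY1 a t)))
  have hA1 : ∀ t, HasDerivAt A1 (A2 t) t := fun t =>
    (di _ _ t (dc4 t)).add (HasDerivAt.fun_sum fun a _ =>
      ((dl2 a t).mul (di _ _ t (dY1 a t))).add ((dl1 a t).mul (di _ _ t (dY2 a t))))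
  have hB : ∀ t, HasDerivAt B (B1 t) t := fun t => (di _ _ t (dc2 t)).const_mul σ
  have cA2 : Continuous A2 :=
    (cc4.inner continuous_const).add (continuous_finsetSum _ fun a _ =>
      (((cl2 a).mul ((cY a).inner continuous_const)).add
        ((cl1 a).mul ((cY1 a).inner continuous_const))).add
      (((cl1 a).mul ((cY1 a).inner continuous_const)).add
        ((cl a).mul ((cY2 a).inner continuous_const))))
  have cB1 : Continuous B1 := continuous_const.mul (cc2.inner continuous_const)
  have cC : Continuous C :=
    (continuous_const.mul ((cVd.comp cc).clm_apply continuous_const)).add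
      (continuous_finsetSum _ fun a _ =>
        (cl a).mul ((((cXd a).comp cc).clm_apply continuous_const).inner cc2))
  have main := aux_fund T hT (fun t => A2 t - B1 t + C t) ((cA2.sub cB1).add cC)
    (fun φ hφ hs => by
      have hφ' : ContDiff ℝ (2:ℕ) φ := contDiff_infty.1 hφ 2
      have dφ1 := aux_d1 hφ' (by norm_num)
      have dφ2 := aux_d2 hφ' (by norm_num)
      have cφ2 : Continuous (iteratedDeriv 2 φ) := hφ'.continuous_iteratedDeriv 2 le_rfl
      have hz : ∀ x, x ∉ Set.Ioo 0 T → φ x = 0 := fun x hx =>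
        image_eq_zero_of_notMem_tsupport fun h => hx (hs h)
      have hz1 : ∀ x, x ∉ Set.Ioo 0 T → deriv φ x = 0 := fun x hx =>
        Function.notMem_support.1 fun h => hx (hs (support_deriv_subset h))
      have n0 : (0:ℝ) ∉ Set.Ioo 0 T := by simp
      have nT : T ∉ Set.Ioo 0 T := by simp
      refine aux_parts T A A1 A2 B B1 C φ (deriv φ) (iteratedDeriv 2 φ) hA hA1 hB dφ1 dφ2
        cA2 cB1 cC cφ2 (hz 0 n0) (hz T nT) (hz1 0 n0) (hz1 T nT) ?_
      have := key (fun t => φ t • w) (fun t => deriv φ t • w) (fun t => iteratedDeriv 2 φ t • w)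
        (fun _ _ => 0) (hφ.smul contDiff_const) (fun _ => contDiff_const)
        (fun t => (dφ1 t).smul_const w) (fun t => (dφ2 t).smul_const w)
        (cφ2.smul continuous_const)
        (by simp [hz 0 n0]) (by simp [hz T nT]) (by simp [hz1 0 n0]) (by simp [hz1 T nT])
      refine Eq.trans ?_ this
      congr 1
      ext t
      simp only [A, B, C, inner_smul_right, inner_smul_left, map_smul, smul_eq_mul, zero_mul,
        zero_add, mul_add, Finset.sum_add_distrib, Finset.mul_sum, conj_trivial]
      have r1 : ∀ a, iteratedDeriv 2 φ t * (lam a t * ⟪X a (c t), w⟫)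
        = lam a t * (iteratedDeriv 2 φ t * ⟪X a (c t), w⟫) := fun a => by ring
      have r2 : ∀ a, φ t * (lam a t * ⟪fderiv ℝ (X a) (c t) w, iteratedDeriv 2 c t⟫)
        = lam a t * (φ t * ⟪fderiv ℝ (X a) (c t) w, iteratedDeriv 2 c t⟫) := fun a => by ring
      simp only [r1, r2]
      ring) t ht
  refine Eq.trans ?_ main
  simp only [A2, B1, C, inner_add_left, inner_sub_left, inner_smul_left, inner_gradient_left,
    Finset.sum_add_distrib, conj_trivial, mul_assoc, ← Finset.mul_sum]
  ring
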